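/- For each p ≥ 1 let G_p(n_0,𝐧) be the homogeneous polynomial of total degree d equal, for all (n_0,𝐧) ∈ ℕ^{r+1}, to lim_{m→∞} dim_𝕜( J(1)_p^{m n_1}⋯J(r)_p^{m n_r} / I_p^{m n_0} J(1)_p^{m n_1}⋯J(r)_p^{m n_r} ) / m^d, and let G(n_0,𝐧) be the homogeneous polynomial of total degree d equal to lim_{m→∞} dim_𝕜( 𝐉_{m𝐧} / I_{m n_0} 𝐉_{m𝐧} ) / m^d. Then for every (n_0,𝐧) ∈ ℕ^{r+1}, lim_{p→∞} G_p(n_0,𝐧)/p^d = G(n_0,𝐧); consequently, writing G(n_0,𝐧) = Σ_{d_0+|𝐝|=d−1} e_{(d_0,𝐝)}(𝕀|𝕁(1),…,𝕁(r)) · n_0^{d_0+1}𝐧^𝐝 / ((d_0+1)!·𝐝!) and G_p(n_0,𝐧) = Σ_{d_0+|𝐝|=d−1} e_{(d_0,𝐝)}(I_p|J(1)_p,…,J(r)_p) · n_0^{d_0+1}𝐧^𝐝 / ((d_0+1)!·𝐝!), one has e_{(d_0,𝐝)}(𝕀|𝕁(1),…,𝕁(r)) = lim_{p→∞} e_{(d_0,𝐝)}(I_p|J(1)_p,…,J(r)_p)/p^d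 for every d_0 ∈ ℕ and 𝐝 ∈ ℕ^r with d_0+|𝐝| = d−1. -/

import Mathlib

open Filter MvPolynomial Pointwise MeasureTheory

noncomputable section

/-- The graded irrelevant (maximal graded) ideal `𝔪 = (x_1, …, x_d)` of `𝕜[x_1, …, x_d]`. -/
def mId (𝕜 : Type*) [Field 𝕜] (d : ℕ) : Ideal (MvPolynomial (Fin d) 𝕜) :=
  Ideal.span (Set.range MvPolynomial.X)

/-- A graded family of ideals: `I 0 = R` and `I i * I j ⊆ I (i + j)`. -/
def IsGradedFamily {R : Type*} [CommSemiring R] (I : ℕ → Ideal R) : Prop :=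
  I 0 = ⊤ ∧ ∀ i j : ℕ, I i * I j ≤ I (i + j)

/-- An `𝔪`-primary ideal of the polynomial ring: a proper ideal containing a power of `𝔪`. -/
def IsMPrimary {𝕜 : Type*} [Field 𝕜] {d : ℕ} (I : Ideal (MvPolynomial (Fin d) 𝕜)) : Prop :=
  I ≠ ⊤ ∧ ∃ k : ℕ, mId 𝕜 d ^ k ≤ I

/-- A monomial ideal: an ideal generated by monomials. -/
def IsMonomialIdeal {𝕜 : Type*} [Field 𝕜] {d : ℕ} (I : Ideal (MvPolynomial (Fin d) 𝕜)) : Prop :=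
  ∃ S : Set (Fin d →₀ ℕ), I = Ideal.span ((fun m => MvPolynomial.monomial m (1 : 𝕜)) '' S)

/-- A nonzero monomial ideal generated by monomials of degree at most `b`;
for nonzero monomial ideals this is exactly the condition `β(I) ≤ b`. -/
def IsMonomialBounded {𝕜 : Type*} [Field 𝕜] {d : ℕ} (I : Ideal (MvPolynomial (Fin d) 𝕜))
    (b : ℕ) : Prop :=
  I ≠ ⊥ ∧ ∃ S : Set (Fin d →₀ ℕ), (∀ m ∈ S, (∑ j, m j) ≤ b) ∧
    I = Ideal.span ((fun m => MvPolynomial.monomial m (1 : 𝕜)) '' S)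

/-- The `𝕜`-vector space dimension of the quotient `A / (A ⊓ B)`; for `B ⊆ A`
this is `dim_𝕜 (A / B)`. -/
def quotDim (𝕜 : Type*) [Field 𝕜] {R : Type*} [CommRing R] [Algebra 𝕜 R]
    (A B : Ideal R) : ℕ :=
  Module.finrank 𝕜
    (↥(Submodule.restrictScalars 𝕜 A) ⧸
      Submodule.comap (Submodule.restrictScalars 𝕜 A).subtype (Submodule.restrictScalars 𝕜 B))

/-- The exponents of the monomials lying in an ideal of the polynomial ring. -/
def expSet {𝕜 : Type*} [Field 𝕜] {d : ℕ} (A : Ideal (MvPolynomial (Fin d) 𝕜)) :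
    Set (Fin d →₀ ℕ) :=
  {u | monomial u (1 : 𝕜) ∈ A}

section MonomialIdeals

variable {𝕜 : Type*} [Field 𝕜] {d : ℕ} {A B : Ideal (MvPolynomial (Fin d) 𝕜)}

lemma mem_expSet {u : Fin d →₀ ℕ} : u ∈ expSet A ↔ monomial u (1 : 𝕜) ∈ A := Iff.rfl

lemma add_mem_expSet_mul {u v : Fin d →₀ ℕ} (hu : u ∈ expSet A) (hv : v ∈ expSet B) :
    u + v ∈ expSet (A * B) := by
  have h := Ideal.mul_mem_mul hu hv
  rwa [monomial_mul, one_mul] at h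

lemma nsmul_mem_expSet_pow {u : Fin d →₀ ℕ} (hu : u ∈ expSet A) (n : ℕ) :
    n • u ∈ expSet (A ^ n) := by
  have h := Ideal.pow_mem_pow hu n
  rwa [monomial_pow, one_pow] at h

lemma expSet_mono (h : A ≤ B) : expSet A ⊆ expSet B := fun _ hu => h hu

lemma mem_expSet_of_le {u v : Fin d →₀ ℕ} (huv : u ≤ v) (hu : u ∈ expSet A) : v ∈ expSet A := by
  have h : monomial v (1 : 𝕜) = monomial (v - u) 1 * monomial u 1 := by
    rw [monomial_mul, one_mul, tsub_add_cancel_of_le huv]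
  rw [mem_expSet, h]
  exact A.mul_mem_left _ hu

lemma mem_expSet_span {S : Set (Fin d →₀ ℕ)} {u : Fin d →₀ ℕ} :
    u ∈ expSet (Ideal.span ((fun m => monomial m (1 : 𝕜)) '' S)) ↔ ∃ s ∈ S, s ≤ u := by
  classical
  rw [mem_expSet, mem_ideal_span_monomial_image]
  simp [support_monomial]

lemma IsMonomialIdeal.mem_iff (hA : IsMonomialIdeal A) {f : MvPolynomial (Fin d) 𝕜} :
    f ∈ A ↔ ∀ u ∈ f.support, u ∈ expSet A := by
  obtain ⟨S, rfl⟩ := hA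
  simp only [mem_expSet_span, mem_ideal_span_monomial_image]

lemma IsMonomialIdeal.le_of_expSet_subset (hA : IsMonomialIdeal A)
    (h : expSet A ⊆ expSet B) : A ≤ B := by
  obtain ⟨S, rfl⟩ := hA
  refine Ideal.span_le.2 ?_
  rintro _ ⟨m, hm, rfl⟩
  exact h (mem_expSet_span.2 ⟨m, hm, le_rfl⟩)

lemma isMonomialIdeal_top : IsMonomialIdeal (⊤ : Ideal (MvPolynomial (Fin d) 𝕜)) := by
  refine ⟨{0}, ?_⟩
  rw [Set.image_singleton, eq_comm, Ideal.eq_top_iff_one]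
  exact Ideal.subset_span (by simp)

lemma span_monomial_mul_span_monomial (S T : Set (Fin d →₀ ℕ)) :
    Ideal.span ((fun m => monomial m (1 : 𝕜)) '' S) *
      Ideal.span ((fun m => monomial m (1 : 𝕜)) '' T) =
      Ideal.span ((fun m => monomial m (1 : 𝕜)) '' (S + T)) := by
  rw [Ideal.span_mul_span']
  congr 1
  ext f
  simp only [Set.mem_mul, Set.mem_image, Set.mem_add]
  constructor
  · rintro ⟨_, ⟨s, hs, rfl⟩, _, ⟨t, ht, rfl⟩, rfl⟩
    exact ⟨s + t, ⟨s, hs, t, ht, rfl⟩, by simp [monomial_mul]⟩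
  · rintro ⟨_, ⟨s, hs, t, ht, rfl⟩, rfl⟩
    exact ⟨_, ⟨s, hs, rfl⟩, _, ⟨t, ht, rfl⟩, by simp [monomial_mul]⟩

lemma IsMonomialIdeal.mul (hA : IsMonomialIdeal A) (hB : IsMonomialIdeal B) :
    IsMonomialIdeal (A * B) := by
  obtain ⟨S, rfl⟩ := hA
  obtain ⟨T, rfl⟩ := hB
  exact ⟨S + T, span_monomial_mul_span_monomial S T⟩

lemma IsMonomialIdeal.exists_add_le (hA : IsMonomialIdeal A) (hB : IsMonomialIdeal B)
    {u : Fin d →₀ ℕ} (hu : u ∈ expSet (A * B)) :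
    ∃ v ∈ expSet A, ∃ w ∈ expSet B, v + w ≤ u := by
  obtain ⟨S, rfl⟩ := hA
  obtain ⟨T, rfl⟩ := hB
  rw [span_monomial_mul_span_monomial, mem_expSet_span] at hu
  obtain ⟨_, ⟨s, hs, t, ht, rfl⟩, h⟩ := hu
  exact ⟨s, mem_expSet_span.2 ⟨s, hs, le_rfl⟩, t, mem_expSet_span.2 ⟨t, ht, le_rfl⟩, h⟩

lemma IsMonomialIdeal.pow (hA : IsMonomialIdeal A) (n : ℕ) : IsMonomialIdeal (A ^ n) := by
  induction n with
  | zero => simpa [Ideal.one_eq_top] using isMonomialIdeal_top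
  | succ n ih => rw [pow_succ]; exact ih.mul hA

lemma IsMonomialIdeal.prod {ι : Type*} (s : Finset ι) {A : ι → Ideal (MvPolynomial (Fin d) 𝕜)}
    (hA : ∀ i, IsMonomialIdeal (A i)) : IsMonomialIdeal (∏ i ∈ s, A i) :=
  Finset.prod_induction _ _ (fun _ _ => IsMonomialIdeal.mul)
    (by simpa [Ideal.one_eq_top] using isMonomialIdeal_top) fun i _ => hA i

lemma IsMonomialIdeal.quotDim_eq (hA : IsMonomialIdeal A) (hB : IsMonomialIdeal B) :
    quotDim 𝕜 A B = (expSet A \ expSet B).ncard := by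
  set T : Set (Fin d →₀ ℕ) := expSet A \ expSet B
  let φ : (Submodule.restrictScalars 𝕜 A) →ₗ[𝕜] (T →₀ 𝕜) :=
    (Finsupp.lsubtypeDomain T ∘ₗ (basisMonomials (Fin d) 𝕜).repr.toLinearMap) ∘ₗ
      (Submodule.restrictScalars 𝕜 A).subtype
  have hφ : ∀ (f : Submodule.restrictScalars 𝕜 A) (t : T), φ f t = coeff t.1 f.1 :=
    fun f t => rfl
  have hker : LinearMap.ker φ =
      Submodule.comap (Submodule.restrictScalars 𝕜 A).subtype
        (Submodule.restrictScalars 𝕜 B) := by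
    ext f
    have hf : (f : MvPolynomial (Fin d) 𝕜) ∈ A := f.2
    rw [LinearMap.mem_ker, Submodule.mem_comap, Submodule.restrictScalars_mem,
      Submodule.subtype_apply, hB.mem_iff]
    rw [hA.mem_iff] at hf
    constructor
    · intro h u hu
      by_contra huB
      have := DFunLike.congr_fun h (⟨u, hf u hu, huB⟩ : T)
      rw [hφ] at this
      exact mem_support_iff.1 hu this
    · intro h
      ext t
      rw [hφ]
      by_contra ht
      exact t.2.2 (h _ (mem_support_iff.2 ht))
  have hsurj : LinearMap.range φ = ⊤ := by
    rw [eq_top_iff, ← Finsupp.basisSingleOne.span_eq, Submodule.span_le]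
    rintro _ ⟨t, rfl⟩
    refine ⟨⟨monomial t.1 1, t.2.1⟩, ?_⟩
    ext s
    rw [hφ]
    classical
    simp [coeff_monomial, Finsupp.single_apply, Subtype.ext_iff]
  rw [quotDim, ← hker, (φ.quotKerEquivRange).finrank_eq, hsurj, finrank_top,
    Module.finrank_eq_nat_card_basis Finsupp.basisSingleOne, Nat.card_coe_set_eq]

end MonomialIdeals

/-- The exponent vector all of whose entries are `t`. -/
def constVec (d t : ℕ) : Fin d →₀ ℕ := Finsupp.equivFunOnFinite.symm fun _ => t

@[simp]
lemma constVec_apply (d t : ℕ) (i : Fin d) : constVec d t i = t := rfl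

lemma nsmul_constVec (d k t : ℕ) : k • constVec d t = constVec d (k * t) := by
  ext i
  simp

section Counting

/-- A set of exponents in the box `[0, N)^(e+1)` lying in `P` but not in the upper set `P'`, where
`P'` contains the diagonal translate of `P` by `σ`, meets every diagonal line in at most `σ`
points. -/
lemma injOn_diagonal_coordinates {e N σ : ℕ} {P P' : Set (Fin (e + 1) →₀ ℕ)}
    (hup : ∀ u ∈ P', ∀ v, u ≤ v → v ∈ P') (hshift : ∀ u ∈ P, u + constVec (e + 1) σ ∈ P') :
    Set.InjOn (fun u : Fin (e + 1) →₀ ℕ => ((fun j : Fin e => u j.succ + N - u 0), u 0 % σ))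
      {u | u ∈ P ∧ u ∉ P' ∧ ∀ i, u i < N} := by
  have key : ∀ u v : Fin (e + 1) →₀ ℕ, u ∈ P → v ∉ P' → (∀ i, u i < N) → (∀ i, v i < N) →
      (∀ j : Fin e, u j.succ + N - u 0 = v j.succ + N - v 0) → u 0 % σ = v 0 % σ →
      v 0 ≤ u 0 := by
    intro u v hu hv hul hvl hd hm
    by_contra! hlt
    have hσ : u 0 + σ ≤ v 0 := by
      have h1 : σ ∣ v 0 - u 0 := (Nat.modEq_iff_dvd' hlt.le).1 hm
      have := Nat.le_of_dvd (by omega) h1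
      omega
    refine hv (hup _ (hshift u hu) _ fun i => ?_)
    rw [Finsupp.add_apply, constVec_apply]
    refine Fin.cases hσ (fun j => ?_) i
    have := hd j
    have := hul 0
    have := hvl 0
    omega
  intro u hu v hv huv
  obtain ⟨huP, huP', hul⟩ := hu
  obtain ⟨hvP, hvP', hvl⟩ := hv
  obtain ⟨hd, hm⟩ := Prod.ext_iff.1 huv
  have hd' : ∀ j : Fin e, u j.succ + N - u 0 = v j.succ + N - v 0 := fun j => congrFun hd j
  have h0 : u 0 = v 0 := le_antisymm
    (key v u hvP huP' hvl hul (fun j => (hd' j).symm) hm.symm) (key u v huP hvP' hul hvl hd' hm)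
  ext i
  refine Fin.cases h0 (fun j => ?_) i
  have := hd' j
  have := hul 0
  omega

lemma ncard_le_of_diagonal_shift {e N σ : ℕ} {P P' S : Set (Fin (e + 1) →₀ ℕ)}
    (hup : ∀ u ∈ P', ∀ v, u ≤ v → v ∈ P') (hshift : ∀ u ∈ P, u + constVec (e + 1) σ ∈ P')
    (hS : ∀ u ∈ S, u ∈ P ∧ u ∉ P' ∧ ∀ i, u i < N) : S.ncard ≤ (2 * N) ^ e * σ := by
  let T : Finset ((Fin e → ℕ) × ℕ) :=
    Fintype.piFinset (fun _ : Fin e => Finset.range (2 * N)) ×ˢ Finset.range σ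
  have hT : (T : Set ((Fin e → ℕ) × ℕ)).ncard = (2 * N) ^ e * σ := by
    rw [Set.ncard_coe_finset, Finset.card_product, Fintype.card_piFinset]
    simp
  rw [← hT]
  refine Set.ncard_le_ncard_of_injOn _ (fun u hu => ?_)
    ((injOn_diagonal_coordinates (N := N) hup hshift).mono hS) T.finite_toSet
  obtain ⟨huP, huP', hul⟩ := hS u hu
  have hσ : 0 < σ := by
    refine Nat.pos_of_ne_zero fun h0 => huP' (hup _ (hshift u huP) _ fun i => ?_)
    simp [h0]
  simp only [T, Finset.coe_product, Set.mem_prod, Finset.mem_coe, Fintype.mem_piFinset,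
    Finset.mem_range]
  refine ⟨fun j => ?_, Nat.mod_lt _ hσ⟩
  have := hul j.succ
  omega

lemma finite_of_forall_lt {d N : ℕ} {S : Set (Fin d →₀ ℕ)} (hS : ∀ u ∈ S, ∀ i, u i < N) :
    S.Finite :=
  (Set.finite_Iic (constVec d N)).subset fun u hu i => (hS u hu i).le

end Counting

section BoundedGenerators

variable {𝕜 : Type*} [Field 𝕜] {d : ℕ}

/-- Every monomial of `A` is divisible by a monomial of `A` with all exponents at most `b`. -/
def HasGensBounded (A : Ideal (MvPolynomial (Fin d) 𝕜)) (b : ℕ) : Prop :=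
  ∀ u ∈ expSet A, ∃ v ∈ expSet A, v ≤ u ∧ ∀ i, v i ≤ b

variable {A B D : Ideal (MvPolynomial (Fin d) 𝕜)}

lemma HasGensBounded.mul (hA : IsMonomialIdeal A) (hB : IsMonomialIdeal B) {a b : ℕ}
    (ha : HasGensBounded A a) (hb : HasGensBounded B b) : HasGensBounded (A * B) (a + b) := by
  intro u hu
  obtain ⟨v, hv, w, hw, hvw⟩ := hA.exists_add_le hB hu
  obtain ⟨v', hv', hvv, hva⟩ := ha v hv
  obtain ⟨w', hw', hww, hwb⟩ := hb w hw
  exact ⟨v' + w', add_mem_expSet_mul hv' hw', (add_le_add hvv hww).trans hvw,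
    fun i => add_le_add (hva i) (hwb i)⟩

lemma hasGensBounded_one : HasGensBounded (1 : Ideal (MvPolynomial (Fin d) 𝕜)) 0 := by
  intro u _
  exact ⟨0, by simp [mem_expSet], zero_le, fun i => le_rfl⟩

lemma HasGensBounded.pow (hA : IsMonomialIdeal A) {a : ℕ} (ha : HasGensBounded A a) (n : ℕ) :
    HasGensBounded (A ^ n) (n * a) := by
  induction n with
  | zero => simpa using hasGensBounded_one
  | succ n ih =>
    rw [pow_succ, Nat.succ_mul]
    exact ih.mul (hA.pow n) hA ha

lemma HasGensBounded.prod {ι : Type*} (s : Finset ι) {A : ι → Ideal (MvPolynomial (Fin d) 𝕜)}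
    (hA : ∀ i, IsMonomialIdeal (A i)) {a : ι → ℕ} (ha : ∀ i, HasGensBounded (A i) (a i)) :
    HasGensBounded (∏ i ∈ s, A i) (∑ i ∈ s, a i) := by
  classical
  induction s using Finset.induction_on with
  | empty => simpa using hasGensBounded_one
  | insert j s hj ih =>
    rw [Finset.prod_insert hj, Finset.sum_insert hj]
    exact (ha j).mul (hA j) (IsMonomialIdeal.prod s hA) ih

lemma HasGensBounded.lt_of_notMem_mul {b c : ℕ} (hA : HasGensBounded A b)
    (hD : ∀ i, Finsupp.single i c ∈ expSet D) {u : Fin d →₀ ℕ} (hu : u ∈ expSet A)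
    (hu' : u ∉ expSet (D * A)) (i : Fin d) : u i < b + c := by
  classical
  by_contra! h
  obtain ⟨v, hv, hvu, hvb⟩ := hA u hu
  refine hu' (mem_expSet_of_le (fun j => ?_) (add_mem_expSet_mul (hD i) hv))
  have h1 := hvu j
  rw [Finsupp.add_apply, Finsupp.single_apply]
  split_ifs with hij
  · subst hij
    have := hvb i
    omega
  · omega

end BoundedGenerators

section Comparison

variable {𝕜 : Type*} [Field 𝕜]

/-- If `A' ⊆ A` and `D' ⊆ D` are monomial ideals such that multiplication by the `W`-th power of
`(x_1 ⋯ x_d)^s` carries `A` into `A'` and `D * A` into `D' * A'`, then the colengths of `D * A`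
in `A` and of `D' * A'` in `A'` are close. -/
lemma abs_quotDim_sub_le {e : ℕ} {A A' D D' : Ideal (MvPolynomial (Fin (e + 1)) 𝕜)}
    (hA : IsMonomialIdeal A) (hA' : IsMonomialIdeal A') (hD : IsMonomialIdeal D)
    (hD' : IsMonomialIdeal D') (hAA : A' ≤ A) (hDD : D' ≤ D) {b c s W : ℕ}
    (hb : HasGensBounded A b) (hb' : HasGensBounded A' b)
    (hc : ∀ i, Finsupp.single i c ∈ expSet D')
    (hsA : A * Ideal.span {monomial (constVec (e + 1) s) (1 : 𝕜)} ^ W ≤ A')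
    (hsD : D * A * Ideal.span {monomial (constVec (e + 1) s) (1 : 𝕜)} ^ W ≤ D' * A') :
    |(quotDim 𝕜 A (D * A) : ℝ) - quotDim 𝕜 A' (D' * A')| ≤
      (2 * (b + c : ℕ) : ℝ) ^ e * (W * s : ℕ) := by
  rw [hA.quotDim_eq (hD.mul hA), hA'.quotDim_eq (hD'.mul hA')]
  have hc' : ∀ i, Finsupp.single i c ∈ expSet D := fun i => expSet_mono hDD (hc i)
  have hQ := expSet_mono (Ideal.mul_mono hDD hAA)
  have hP := expSet_mono hAA
  have hZ : constVec (e + 1) (W * s) ∈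
      expSet (Ideal.span {monomial (constVec (e + 1) s) (1 : 𝕜)} ^ W) := by
    rw [← nsmul_constVec]
    exact nsmul_mem_expSet_pow (Ideal.mem_span_singleton_self _) W
  have hup : ∀ B : Ideal (MvPolynomial (Fin (e + 1)) 𝕜), ∀ u ∈ expSet B, ∀ v, u ≤ v →
      v ∈ expSet B := fun B u hu v huv => mem_expSet_of_le huv hu
  have hX : ∀ u ∈ expSet A \ expSet (D * A), ∀ i, u i < b + c :=
    fun u hu i => hb.lt_of_notMem_mul hc' hu.1 hu.2 i
  have hY : ∀ u ∈ expSet A' \ expSet (D' * A'), ∀ i, u i < b + c :=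
    fun u hu i => hb'.lt_of_notMem_mul hc hu.1 hu.2 i
  have h1 := Set.ncard_le_ncard_sdiff_add_ncard (expSet A \ expSet (D * A)) _
    (finite_of_forall_lt hY)
  have h2 := Set.ncard_le_ncard_sdiff_add_ncard (expSet A' \ expSet (D' * A')) _
    (finite_of_forall_lt hX)
  have h3 : ((expSet A \ expSet (D * A)) \ (expSet A' \ expSet (D' * A'))).ncard ≤
      (2 * (b + c)) ^ e * (W * s) :=
    ncard_le_of_diagonal_shift (hup A')
      (fun u hu => expSet_mono hsA (add_mem_expSet_mul hu hZ))
      fun u hu => ⟨hu.1.1, fun h => hu.2 ⟨h, fun h' => hu.1.2 (hQ h')⟩, hX u hu.1⟩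
  have h4 : ((expSet A' \ expSet (D' * A')) \ (expSet A \ expSet (D * A))).ncard ≤
      (2 * (b + c)) ^ e * (W * s) :=
    ncard_le_of_diagonal_shift (hup (D' * A'))
      (fun u hu => expSet_mono hsD (add_mem_expSet_mul hu hZ))
      fun u hu => ⟨by_contra fun h => hu.2 ⟨hP hu.1.1, h⟩, hu.1.2, hY u hu.1⟩
  rw [abs_sub_le_iff, sub_le_iff_le_add, sub_le_iff_le_add]
  exact ⟨by exact_mod_cast h1.trans (Nat.add_le_add_right h3 _),
    by exact_mod_cast h2.trans (Nat.add_le_add_right h4 _)⟩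

end Comparison

lemma IsGradedFamily.pow_le {R : Type*} [CommSemiring R] {J : ℕ → Ideal R}
    (hJ : IsGradedFamily J) (k n : ℕ) : J k ^ n ≤ J (k * n) := by
  induction n with
  | zero => simp [hJ.1]
  | succ n ih =>
    rw [pow_succ, Nat.mul_succ]
    exact (Ideal.mul_mono_left ih).trans (hJ.2 _ _)

section GradedFamilies

variable {𝕜 : Type*} [Field 𝕜] {d : ℕ} {J : ℕ → Ideal (MvPolynomial (Fin d) 𝕜)}

lemma exists_constVec_mem (hne : ∀ n, (expSet (J n)).Nonempty) (k : ℕ) :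
    ∃ c, ∀ n < k, constVec d c ∈ expSet (J n) := by
  choose g hg using hne
  refine ⟨∑ n ∈ Finset.range k, ∑ i, g n i, fun n hn => mem_expSet_of_le (fun i => ?_) (hg n)⟩
  rw [constVec_apply]
  exact (Finset.single_le_sum (f := fun i => g n i) (fun _ _ => Nat.zero_le _)
    (Finset.mem_univ i)).trans
    (Finset.single_le_sum (f := fun n => ∑ i, g n i) (fun _ _ => Nat.zero_le _)
      (Finset.mem_range.2 hn))

/-- The shift estimate for the exponents `u` of `J (p * m)` such that `u / (p * m)` lies in a fixed
cube of side `1 / L`. -/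
lemma eventually_add_constVec_mem_of_cell (hJ : IsGradedFamily J)
    (hne : ∀ n, (expSet (J n)).Nonempty) {L : ℕ} (hL : 0 < L) (v : Fin d → ℕ) :
    ∀ᶠ p in atTop, ∀ m, 0 < m → ∀ u ∈ expSet (J (p * m)), (∀ i, L * u i / (p * m) = v i) →
      ∀ s, 2 * (p * m) ≤ L * s → u + constVec d s ∈ expSet (J p ^ m) := by
  by_cases h : ∃ k, 0 < k ∧ ∃ a ∈ expSet (J k), ∀ i, L * a i / k = v i
  · obtain ⟨k, hk, a, ha, hav⟩ := h
    obtain ⟨c, hc⟩ := exists_constVec_mem hne k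
    filter_upwards [eventually_ge_atTop (L * c), eventually_gt_atTop 0] with p hp hp0
    intro m hm u _ huv s hs
    have hmem : (p / k) • a + constVec d c ∈ expSet (J p) := by
      have h1 : J k ^ (p / k) * J (p % k) ≤ J p := by
        refine (Ideal.mul_mono_left (hJ.pow_le k (p / k))).trans ((hJ.2 _ _).trans ?_)
        rw [Nat.div_add_mod]
      exact expSet_mono h1
        (add_mem_expSet_mul (nsmul_mem_expSet_pow ha _) (hc _ (Nat.mod_lt _ hk)))
    refine mem_expSet_of_le (fun i => ?_) (nsmul_mem_expSet_pow hmem m)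
    simp only [Finsupp.smul_apply, Finsupp.add_apply, constVec_apply, smul_eq_mul]
    refine Nat.le_of_mul_le_mul_left ?_ hL
    have h1 : L * a i ≤ k * (v i + 1) := by
      rw [← hav i]
      exact (Nat.lt_mul_div_succ _ hk).le
    have h2 : v i * (p * m) ≤ L * u i := by
      rw [← huv i]
      exact Nat.div_mul_le_self _ _
    have h3 : p / k * k ≤ p := Nat.div_mul_le_self _ _
    calc L * (m * (p / k * a i + c)) = (L * a i) * (m * (p / k)) + L * c * m := by ring
      _ ≤ (k * (v i + 1)) * (m * (p / k)) + p * m := by gcongr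
      _ = (p / k * k) * m * (v i + 1) + p * m := by ring
      _ ≤ p * m * (v i + 1) + p * m := by gcongr
      _ = v i * (p * m) + 2 * (p * m) := by ring
      _ ≤ L * u i + L * s := add_le_add h2 hs
      _ = L * (u i + s) := by ring
  · filter_upwards [eventually_gt_atTop 0] with p hp m hm u hu huv
    exact absurd ⟨p * m, Nat.mul_pos hp hm, u, hu, huv⟩ h

/-- For a graded family `J` of nonzero monomial ideals with linearly bounded generators, and for
all large `p`, the exponents of `J (p * m)` lie in `J p ^ m` after a diagonal translation by a small
multiple of `p * m`. -/
lemma eventually_add_constVec_mem (hJ : IsGradedFamily J)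
    (hne : ∀ n, (expSet (J n)).Nonempty) {β : ℕ} (hb : ∀ n, HasGensBounded (J n) (β * n))
    {L : ℕ} (hL : 0 < L) :
    ∀ᶠ p in atTop, ∀ m, ∀ u ∈ expSet (J (p * m)), ∀ s, 2 * (p * m) ≤ L * s →
      u + constVec d s ∈ expSet (J p ^ m) := by
  have hcells : ∀ᶠ p in atTop, ∀ v : Fin d → Fin (L * β + 1), ∀ m, 0 < m →
      ∀ u ∈ expSet (J (p * m)), (∀ i, L * u i / (p * m) = v i) →
      ∀ s, 2 * (p * m) ≤ L * s → u + constVec d s ∈ expSet (J p ^ m) :=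
    eventually_all.2 fun v => eventually_add_constVec_mem_of_cell hJ hne hL fun i => v i
  filter_upwards [hcells] with p hp m u hu s hs
  rcases Nat.eq_zero_or_pos m with rfl | hm
  · simp [mem_expSet]
  obtain ⟨v, hv, hvu, hvb⟩ := hb _ u hu
  have hcell : ∀ i, L * v i / (p * m) < L * β + 1 := fun i => by
    refine Nat.lt_succ_of_le (Nat.div_le_of_le_mul ?_)
    calc L * v i ≤ L * (β * (p * m)) := Nat.mul_le_mul_left _ (hvb i)
      _ = p * m * (L * β) := by ring
  exact mem_expSet_of_le (add_le_add hvu le_rfl)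
    (hp (fun i => ⟨_, hcell i⟩) m hm v hv (fun i => rfl) s hs)

lemma eventually_mul_span_pow_le (hJ : IsGradedFamily J) (hmon : ∀ n, IsMonomialIdeal (J n))
    (hne : ∀ n, (expSet (J n)).Nonempty) {β : ℕ} (hb : ∀ n, HasGensBounded (J n) (β * n))
    {L : ℕ} (hL : 0 < L) :
    ∀ᶠ p in atTop, ∀ m s, 2 * (p * m) ≤ L * s → ∀ n,
      J (m * (p * n)) * Ideal.span {monomial (constVec d s) (1 : 𝕜)} ^ n ≤ J p ^ (m * n) := by
  filter_upwards [eventually_add_constVec_mem hJ hne hb hL] with p hp m s hs n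
  have hZ : Ideal.span {monomial (constVec d s) (1 : 𝕜)} ^ n =
      Ideal.span ((fun m => monomial m (1 : 𝕜)) '' {constVec d (n * s)}) := by
    rw [Ideal.span_singleton_pow, monomial_pow, one_pow, nsmul_constVec, Set.image_singleton]
  rw [hZ]
  have hZmon : IsMonomialIdeal
      (Ideal.span ((fun m => monomial m (1 : 𝕜)) '' {constVec d (n * s)})) := ⟨_, rfl⟩
  refine ((hmon _).mul hZmon).le_of_expSet_subset fun u hu => ?_
  obtain ⟨v, hv, w, hw, hvw⟩ := (hmon _).exists_add_le hZmon hu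
  obtain ⟨_, rfl, hw'⟩ := mem_expSet_span.1 hw
  refine mem_expSet_of_le ((add_le_add le_rfl hw').trans hvw) (hp (m * n) v ?_ _ ?_)
  · rwa [mul_left_comm p m n]
  · calc 2 * (p * (m * n)) = n * (2 * (p * m)) := by ring
      _ ≤ n * (L * s) := Nat.mul_le_mul_left _ hs
      _ = L * (n * s) := by ring

end GradedFamilies

section Hypotheses

variable {𝕜 : Type*} [Field 𝕜] {d : ℕ} {A : Ideal (MvPolynomial (Fin d) 𝕜)}

lemma IsMonomialBounded.isMonomialIdeal {b : ℕ} (hA : IsMonomialBounded A b) :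
    IsMonomialIdeal A := by
  obtain ⟨-, S, -, hS⟩ := hA
  exact ⟨S, hS⟩

lemma IsMonomialBounded.hasGensBounded {b : ℕ} (hA : IsMonomialBounded A b) :
    HasGensBounded A b := by
  obtain ⟨-, S, hb, rfl⟩ := hA
  intro u hu
  obtain ⟨s, hs, hsu⟩ := mem_expSet_span.1 hu
  exact ⟨s, mem_expSet_span.2 ⟨s, hs, le_rfl⟩, hsu, fun i =>
    (Finset.single_le_sum (f := fun i => s i) (fun _ _ => Nat.zero_le _)
      (Finset.mem_univ i)).trans (hb s hs)⟩

lemma IsMonomialBounded.expSet_nonempty {b : ℕ} (hA : IsMonomialBounded A b) :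
    (expSet A).Nonempty := by
  obtain ⟨hne, S, -, rfl⟩ := hA
  have hS : S.Nonempty := by
    rw [Set.nonempty_iff_ne_empty]
    rintro rfl
    simp at hne
  obtain ⟨s, hs⟩ := hS
  exact ⟨s, mem_expSet_span.2 ⟨s, hs, le_rfl⟩⟩

lemma hasGensBounded_of_single_mem {c : ℕ} (hc : ∀ i, Finsupp.single i c ∈ expSet A) :
    HasGensBounded A c := by
  classical
  intro u hu
  by_cases h : ∃ i, c < u i
  · obtain ⟨i, hi⟩ := h
    refine ⟨Finsupp.single i c, hc i, fun j => ?_, fun j => ?_⟩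
    · rw [Finsupp.single_apply]
      split_ifs with hij
      · exact hij ▸ hi.le
      · exact Nat.zero_le _
    · rw [Finsupp.single_apply]
      split_ifs <;> omega
  · push Not at h
    exact ⟨u, hu, le_rfl, h⟩

lemma IsMPrimary.exists_single_mem (hA : IsMPrimary A) :
    ∃ c, ∀ i, Finsupp.single i c ∈ expSet A := by
  obtain ⟨-, c, hc⟩ := hA
  refine ⟨c, fun i => ?_⟩
  have hX : (X i : MvPolynomial (Fin d) 𝕜) ∈ mId 𝕜 d := Ideal.subset_span (Set.mem_range_self i)
  rw [mem_expSet, ← X_pow_eq_monomial]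
  exact hc (Ideal.pow_mem_pow hX c)

end Hypotheses

section Coefficients

/-- Each coefficient of a homogeneous polynomial of degree `d` is a fixed linear combination of its
values at finitely many natural points. -/
lemma exists_coeff_eq_sum_eval (k d : ℕ) (e : Fin k →₀ ℕ) :
    ∃ c : (Fin k → Fin (d + 1)) → ℝ, ∀ H : MvPolynomial (Fin k) ℝ, H.IsHomogeneous d →
      H.coeff e = ∑ x, c x * eval (fun i => ((x i : ℕ) : ℝ)) H := by
  let V := homogeneousSubmodule (Fin k) ℝ d
  let ev : (Fin k → Fin (d + 1)) → V →ₗ[ℝ] ℝ := fun x =>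
    (aeval fun i => ((x i : ℕ) : ℝ)).toLinearMap ∘ₗ V.subtype
  let co : V →ₗ[ℝ] ℝ := lcoeff ℝ e ∘ₗ V.subtype
  have hco : co ∈ Submodule.span ℝ (Set.range ev) := by
    refine mem_span_of_iInf_ker_le_ker fun H hH => ?_
    have hzero : (H : MvPolynomial (Fin k) ℝ) = 0 := by
      refine eq_zero_of_eval_zero_at_prod_finset _
        (fun _ => Finset.univ.image fun j : Fin (d + 1) => ((j : ℕ) : ℝ)) (fun i => ?_)
        fun x hx => ?_
      · rw [Finset.card_image_of_injective _ (fun a b h => Fin.ext (by exact_mod_cast h)),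
          Finset.card_univ, Fintype.card_fin]
        exact Nat.lt_succ_of_le ((degreeOf_le_totalDegree _ _).trans
          (IsHomogeneous.totalDegree_le H.2))
      · choose y hy using fun i => Finset.mem_image.1 (hx i)
        have h1 := LinearMap.mem_ker.1 ((Submodule.mem_iInf _).1 hH y)
        have h2 : (fun i => ((y i : ℕ) : ℝ)) = x := funext fun i => (hy i).2
        have h3 : ev y H = eval (fun i => ((y i : ℕ) : ℝ)) H.1 := by
          simp [ev, aeval_eq_eval]
        rw [← h2, ← h3, h1]
    rw [LinearMap.mem_ker, show H = 0 from Subtype.ext hzero, map_zero]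
  obtain ⟨c, hc⟩ := (Submodule.mem_span_range_iff_exists_fun ℝ).1 hco
  refine ⟨c, fun H hH => ?_⟩
  have h := LinearMap.congr_fun hc ⟨H, hH⟩
  simpa [ev, co, aeval_eq_eval, LinearMap.sum_apply] using h.symm

lemma tendsto_coeff_div_of_tendsto_eval_div {k d : ℕ} {G : MvPolynomial (Fin k) ℝ}
    {F : ℕ → MvPolynomial (Fin k) ℝ} {a : ℕ → ℝ} (hG : G.IsHomogeneous d)
    (hF : ∀ᶠ p in atTop, (F p).IsHomogeneous d)
    (h : ∀ x : Fin k → ℕ, Tendsto (fun p => eval (fun i => (x i : ℝ)) (F p) / a p) atTop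
      (nhds (eval (fun i => (x i : ℝ)) G))) (e : Fin k →₀ ℕ) :
    Tendsto (fun p => (F p).coeff e / a p) atTop (nhds (G.coeff e)) := by
  obtain ⟨c, hc⟩ := exists_coeff_eq_sum_eval k d e
  rw [hc G hG]
  refine (tendsto_finsetSum _ fun x _ => (h fun i => x i).const_mul (c x)).congr' ?_
  filter_upwards [hF] with p hp
  rw [hc _ hp, Finset.sum_div]
  exact Finset.sum_congr rfl fun x _ => (mul_div_assoc _ _ _).symm

lemma MvPolynomial.IsHomogeneous.eval_const_mul {σ R : Type*} [CommSemiring R]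
    {G : MvPolynomial σ R} {d : ℕ} (hG : G.IsHomogeneous d) (c : R) (x : σ → R) :
    eval (fun i => c * x i) G = c ^ d * eval x G := by
  rw [eval_eq, eval_eq, Finset.mul_sum]
  refine Finset.sum_congr rfl fun m hm => ?_
  have hdeg : ∑ i ∈ m.support, m i = d := by
    have h := hG (mem_support_iff.1 hm)
    rwa [Finsupp.weight_apply, Finsupp.sum, Finset.sum_congr rfl
      (fun i _ => by simp : ∀ i ∈ m.support, m i • (1 : σ → ℕ) i = m i)] at h
  rw [← hdeg, ← Finset.prod_pow_eq_pow_sum]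
  simp only [mul_pow, Finset.prod_mul_distrib]
  ring

end Coefficients

/-- Uniform comparison of the colengths attached to graded families with those attached to the
power filtrations of their `p`-th members. -/
lemma eventually_abs_quotDim_sub_le {𝕜 : Type*} [Field 𝕜] {e r : ℕ}
    {I : ℕ → Ideal (MvPolynomial (Fin (e + 1)) 𝕜)}
    {J : Fin r → ℕ → Ideal (MvPolynomial (Fin (e + 1)) 𝕜)} {β : ℕ}
    (hI : IsGradedFamily I) (hImon : ∀ n, IsMonomialIdeal (I n)) (hIprim : IsMPrimary (I 1))
    (hJ : ∀ i, IsGradedFamily (J i)) (hJb : ∀ i n, IsMonomialBounded (J i n) (β * n))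
    (n0 : ℕ) (n : Fin r → ℕ) :
    ∃ C : ℝ, ∀ L : ℕ, 0 < L → ∀ᶠ p in atTop, ∀ m : ℕ, L ≤ m →
      |(quotDim 𝕜 (∏ i, J i (m * (p * n i)))
          (I (m * (p * n0)) * ∏ i, J i (m * (p * n i))) : ℝ) -
        quotDim 𝕜 (∏ i, J i p ^ (m * n i)) (I p ^ (m * n0) * ∏ i, J i p ^ (m * n i))| ≤
      C / L * (p : ℝ) ^ (e + 1) * (m : ℝ) ^ (e + 1) := by
  obtain ⟨c, hc⟩ := hIprim.exists_single_mem
  have hcI : ∀ k i, Finsupp.single i (c * k) ∈ expSet (I k) := fun k i => by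
    have h := expSet_mono (hI.pow_le 1 k) (nsmul_mem_expSet_pow (hc i) k)
    rwa [Finsupp.smul_single, smul_eq_mul, one_mul, mul_comm] at h
  have hIb : ∀ k, HasGensBounded (I k) (c * k) := fun k => hasGensBounded_of_single_mem (hcI k)
  have hIne : ∀ k, (expSet (I k)).Nonempty := fun k => ⟨_, hcI k 0⟩
  have hJmon : ∀ i k, IsMonomialIdeal (J i k) := fun i k => (hJb i k).isMonomialIdeal
  set K : ℕ := β * ∑ i, n i + c * n0 with hK
  set W : ℕ := n0 + ∑ i, n i with hW
  refine ⟨(2 * (K : ℝ)) ^ e * W * 3, fun L hL => ?_⟩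
  have hJev : ∀ᶠ p in atTop, ∀ i m s, 2 * (p * m) ≤ L * s → ∀ k,
      J i (m * (p * k)) * Ideal.span {monomial (constVec (e + 1) s) (1 : 𝕜)} ^ k ≤
        J i p ^ (m * k) :=
    eventually_all.2 fun i => eventually_mul_span_pow_le (hJ i) (hJmon i)
      (fun k => (hJb i k).expSet_nonempty) (fun k => (hJb i k).hasGensBounded) hL
  filter_upwards [hJev, eventually_mul_span_pow_le hI hImon hIne hIb hL,
    eventually_gt_atTop 0] with p hpJ hpI hp m hm
  have hm0 : 0 < m := hL.trans_le hm
  set s : ℕ := 2 * (p * m) / L + 1 with hs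
  have hs1 : 2 * (p * m) ≤ L * s := (Nat.lt_mul_div_succ _ hL).le
  have hs2 : L * s ≤ 3 * (p * m) := by
    have h1 : L * (2 * (p * m) / L) ≤ 2 * (p * m) := Nat.mul_div_le _ _
    have h2 : L ≤ p * m := hm.trans (Nat.le_mul_of_pos_left m hp)
    rw [hs, Nat.mul_succ]
    omega
  set Z : Ideal (MvPolynomial (Fin (e + 1)) 𝕜) :=
    Ideal.span {monomial (constVec (e + 1) s) (1 : 𝕜)} with hZ
  have hAZ : (∏ i, J i (m * (p * n i))) * Z ^ ∑ i, n i ≤ ∏ i, J i p ^ (m * n i) := by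
    rw [← Finset.prod_pow_eq_pow_sum, ← Finset.prod_mul_distrib]
    exact Finset.prod_le_prod' fun i _ => hpJ i m s hs1 (n i)
  have hDZ : I (m * (p * n0)) * Z ^ n0 ≤ I p ^ (m * n0) := hpI m s hs1 n0
  have hsub : ∀ {F : ℕ → Ideal (MvPolynomial (Fin (e + 1)) 𝕜)}, IsGradedFamily F → ∀ k,
      F p ^ (m * k) ≤ F (m * (p * k)) := fun hF k => by
    rw [mul_left_comm]
    exact hF.pow_le p (m * k)
  have hsum : ∀ f : Fin r → ℕ, (∀ i, f i = β * (p * m) * n i) →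
      ∑ i, f i = β * (p * m) * ∑ i, n i := fun f hf => by
    rw [Finset.mul_sum]
    exact Finset.sum_congr rfl fun i _ => hf i
  have hmain := abs_quotDim_sub_le (A := ∏ i, J i (m * (p * n i)))
    (A' := ∏ i, J i p ^ (m * n i)) (D := I (m * (p * n0))) (D' := I p ^ (m * n0))
    (b := β * (p * m) * ∑ i, n i) (c := m * n0 * (c * p)) (s := s) (W := W)
    (IsMonomialIdeal.prod _ fun i => hJmon i _)
    (IsMonomialIdeal.prod _ fun i => (hJmon i _).pow _) (hImon _) ((hImon _).pow _)
    (Finset.prod_le_prod' fun i _ => hsub (hJ i) _) (hsub hI _)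
    (by
      rw [← hsum (fun i => β * (m * (p * n i))) fun i => by ring]
      exact HasGensBounded.prod _ (fun i => hJmon i _) fun i => (hJb i _).hasGensBounded)
    (by
      rw [← hsum (fun i => m * n i * (β * p)) fun i => by ring]
      exact HasGensBounded.prod _ (fun i => (hJmon i _).pow _)
        fun i => (hJb i _).hasGensBounded.pow (hJmon i _) _)
    (fun i => by
      have h := nsmul_mem_expSet_pow (hcI p i) (m * n0)
      rwa [Finsupp.smul_single, smul_eq_mul] at h)
    ((Ideal.mul_mono_right (Ideal.pow_le_pow_right (Nat.le_add_left _ _))).trans hAZ)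
    (by
      rw [hW, pow_add, mul_mul_mul_comm]
      exact Ideal.mul_mono hDZ hAZ)
  refine hmain.trans ?_
  have hKb : β * (p * m) * ∑ i, n i + m * n0 * (c * p) = K * (p * m) := by
    rw [hK]
    ring
  have hL' : (0 : ℝ) < L := by exact_mod_cast hL
  have hs' : (s : ℝ) ≤ 3 * (p * m) / L := by
    rw [le_div_iff₀ hL', mul_comm]
    exact_mod_cast hs2
  rw [hKb]
  push_cast
  calc (2 * ((K : ℝ) * (p * m))) ^ e * (W * s)
      ≤ (2 * ((K : ℝ) * (p * m))) ^ e * (W * (3 * (p * m) / L)) := by gcongr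
    _ = (2 * (K : ℝ)) ^ e * W * 3 / L * (p : ℝ) ^ (e + 1) * (m : ℝ) ^ (e + 1) := by
      simp only [mul_pow, pow_succ]
      ring

/-- **Theorem B ("Volume = Multiplicity" for mixed multiplicities).**
Let `G` be the homogeneous degree-`d` polynomial computing the limits
`lim_m dim_𝕜(𝐉_{m𝐧}/I_{m n₀}𝐉_{m𝐧})/m^d` for the graded families, and for each `p ≥ 1` let
`G_p` be the homogeneous degree-`d` polynomial computing the corresponding limits for the
power filtrations of `I_p, J(1)_p, …, J(r)_p`.  Then `G_p(n₀,𝐧)/p^d → G(n₀,𝐧)` for every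
`(n₀,𝐧) ∈ ℕ^{r+1}`, and consequently every coefficient of `G_p/p^d` converges to the
corresponding coefficient of `G`; i.e.
`e_{(d₀,𝐝)}(𝕀|𝕁(1),…,𝕁(r)) = lim_p e_{(d₀,𝐝)}(I_p|J(1)_p,…,J(r)_p)/p^d`. -/
theorem statement3 {𝕜 : Type*} [Field 𝕜] (d r : ℕ) (hd : 0 < d)
    (I : ℕ → Ideal (MvPolynomial (Fin d) 𝕜))
    (J : Fin r → ℕ → Ideal (MvPolynomial (Fin d) 𝕜)) (β : ℕ)
    (hI : IsGradedFamily I)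
    (hImon : ∀ n, IsMonomialIdeal (I n))
    (hIprim : ∀ n, 0 < n → IsMPrimary (I n))
    (hJ : ∀ i, IsGradedFamily (J i))
    (hJb : ∀ i n, IsMonomialBounded (J i n) (β * n))
    (G : MvPolynomial (Fin (r + 1)) ℝ)
    (Gp : ℕ → MvPolynomial (Fin (r + 1)) ℝ)
    (hGhom : G.IsHomogeneous d)
    (hGlim : ∀ (n0 : ℕ) (n : Fin r → ℕ),
      Tendsto
        (fun m : ℕ =>
          (quotDim 𝕜 (∏ i, J i (m * n i)) (I (m * n0) * ∏ i, J i (m * n i)) : ℝ) /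
            (m : ℝ) ^ d)
        atTop
        (nhds (MvPolynomial.eval (Fin.cons (n0 : ℝ) fun i => (n i : ℝ)) G)))
    (hGphom : ∀ p : ℕ, 0 < p → (Gp p).IsHomogeneous d)
    (hGplim : ∀ p : ℕ, 0 < p → ∀ (n0 : ℕ) (n : Fin r → ℕ),
      Tendsto
        (fun m : ℕ =>
          (quotDim 𝕜 (∏ i, J i p ^ (m * n i)) (I p ^ (m * n0) * ∏ i, J i p ^ (m * n i)) : ℝ) /
            (m : ℝ) ^ d)
        atTop
        (nhds (MvPolynomial.eval (Fin.cons (n0 : ℝ) fun i => (n i : ℝ)) (Gp p)))) :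
    (∀ (n0 : ℕ) (n : Fin r → ℕ),
        Tendsto
          (fun p : ℕ =>
            MvPolynomial.eval (Fin.cons (n0 : ℝ) fun i => (n i : ℝ)) (Gp p) / (p : ℝ) ^ d)
          atTop
          (nhds (MvPolynomial.eval (Fin.cons (n0 : ℝ) fun i => (n i : ℝ)) G))) ∧
      ∀ e : Fin (r + 1) →₀ ℕ,
        Tendsto (fun p : ℕ => (Gp p).coeff e / (p : ℝ) ^ d) atTop (nhds (G.coeff e)) := by
  obtain ⟨e, rfl⟩ : ∃ e, d = e + 1 := ⟨d - 1, by omega⟩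
  have hcast : ∀ (n0 : ℕ) (n : Fin r → ℕ) (q : ℕ),
      (Fin.cons ((q * n0 : ℕ) : ℝ) (fun i => ((q * n i : ℕ) : ℝ)) : Fin (r + 1) → ℝ) =
        fun i => (q : ℝ) * (Fin.cons (n0 : ℝ) (fun i => (n i : ℝ)) : Fin (r + 1) → ℝ) i := by
    intro n0 n q
    funext i
    refine Fin.cases ?_ (fun j => ?_) i <;> simp
  have hpoint : ∀ (n0 : ℕ) (n : Fin r → ℕ),
      Tendsto
        (fun p : ℕ =>
          MvPolynomial.eval (Fin.cons (n0 : ℝ) fun i => (n i : ℝ)) (Gp p) / (p : ℝ) ^ (e + 1))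
        atTop
        (nhds (MvPolynomial.eval (Fin.cons (n0 : ℝ) fun i => (n i : ℝ)) G)) := by
    intro n0 n
    obtain ⟨C, hC⟩ := eventually_abs_quotDim_sub_le hI hImon (hIprim 1 one_pos) hJ hJb n0 n
    have hbound : ∀ L : ℕ, 0 < L → ∀ᶠ p : ℕ in atTop,
        |MvPolynomial.eval (Fin.cons (n0 : ℝ) fun i => (n i : ℝ)) (Gp p) / (p : ℝ) ^ (e + 1) -
          MvPolynomial.eval (Fin.cons (n0 : ℝ) fun i => (n i : ℝ)) G| ≤ C / L := by
      intro L hL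
      filter_upwards [hC L hL, eventually_gt_atTop 0] with p hp hp0
      have hp0' : (0 : ℝ) < (p : ℝ) ^ (e + 1) := by positivity
      have hlim := ((hGlim (p * n0) fun i => p * n i).sub (hGplim p hp0 n0 n)).abs
      rw [hcast, hGhom.eval_const_mul] at hlim
      have hle := le_of_tendsto hlim (b := C / L * (p : ℝ) ^ (e + 1)) (by
        filter_upwards [eventually_ge_atTop L] with m hm
        have hm0 : (0 : ℝ) < (m : ℝ) ^ (e + 1) := by
          have : 0 < m := hL.trans_le hm
          positivity
        rw [← sub_div, abs_div, abs_of_pos hm0, div_le_iff₀ hm0]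
        exact hp m hm)
      rw [div_sub' hp0'.ne', abs_div, abs_of_pos hp0', div_le_iff₀ hp0', abs_sub_comm]
      exact hle
    rw [Metric.tendsto_nhds]
    intro ε hε
    obtain ⟨L, hL⟩ := exists_nat_gt (max (C / ε) 0)
    have hL0 : (0 : ℝ) < L := (le_max_right _ _).trans_lt hL
    filter_upwards [hbound L (by exact_mod_cast hL0)] with p hp
    rw [Real.dist_eq]
    refine hp.trans_lt ?_
    rw [div_lt_iff₀ hL0, mul_comm, ← div_lt_iff₀ hε]
    exact (le_max_left _ _).trans_lt hL
  refine ⟨hpoint, tendsto_coeff_div_of_tendsto_eval_div hGhom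
    ((eventually_gt_atTop 0).mono hGphom) fun x => ?_⟩
  have hx : (fun i => (x i : ℝ)) =
      (Fin.cons (x 0 : ℝ) (fun i => (x (Fin.succ i) : ℝ)) : Fin (r + 1) → ℝ) := by
    funext i
    refine Fin.cases ?_ (fun j => ?_) i <;> simp
  rw [hx]
  exact hpoint (x 0) fun i => x i.succ
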